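/- Let I be a nonempty proper subset of {1,…,n}, J := {1,…,n} \ I, and let (σ⁻_{ij})_{i∈I, j∈J} be an admissible family (the rank-one condition is not assumed). Suppose that V1 := cone({e^i ⊕ λ·e^j : i ∈ I, j ∈ J, λ ∈ σ⁻_{ij}}) is a conical hemispace, and define V2 := cone({e^i ⊕ λ·e^j : i ∈ I, j ∈ J, λ ∈ σ⁺_{ij}}), using the convention e^i ⊕ (+∞)·e^j := e^j. Then V1 ∩ V2 = {0} and V1 ∪ V2 = ℝ≥0^n; equivalently, V2 = (ℝ≥0^n \ V1) ∪ {0}. -/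

import Mathlib

open scoped NNReal

/-- A set in `ℝ≥0^n` is tropically convex (max-times model). -/
def TropConvex {n : ℕ} (C : Set (Fin n → ℝ≥0)) : Prop :=
  ∀ x ∈ C, ∀ y ∈ C, ∀ α β : ℝ≥0, max α β = 1 →
    (fun i => max (α * x i) (β * y i)) ∈ C

/-- A tropical cone: a nonempty set closed under coordinatewise max and scalar multiplication. -/
def TropCone {n : ℕ} (V : Set (Fin n → ℝ≥0)) : Prop :=
  V.Nonempty ∧ (∀ x ∈ V, ∀ y ∈ V, (fun i => max (x i) (y i)) ∈ V) ∧
    ∀ x ∈ V, ∀ lam : ℝ≥0, (fun i => lam * x i) ∈ V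

/-- Support of a vector. -/
def supp {n : ℕ} (x : Fin n → ℝ≥0) : Set (Fin n) := {i | x i ≠ 0}

/-- Quasisector of type `i` at `y`. -/
def quasiSector {n : ℕ} (y : Fin n → ℝ≥0) (i : Fin n) : Set (Fin n → ℝ≥0) :=
  {x | (∀ j ∈ supp y, x j * y i ≤ x i * y j) ∧ ∀ j ∉ supp y, x j = 0}


/-- Sector of type `i ∈ supp y` at `y`. -/
def sector {n : ℕ} (y : Fin n → ℝ≥0) (i : Fin n) : Set (Fin n → ℝ≥0) :=
  {x | (∀ j ∈ supp y, x j * y i ≤ x i * y j) ∧ y i ≤ x i ∧ ∀ j ∉ supp y, x j = 0}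

/-- Sector of type `n+1` at `y`. -/
def sectorTop {n : ℕ} (y : Fin n → ℝ≥0) : Set (Fin n → ℝ≥0) :=
  {x | ∀ j, x j ≤ y j}

/-- The `i`-th unit vector. -/
def unitVec {n : ℕ} (i : Fin n) : Fin n → ℝ≥0 := fun k => if k = i then 1 else 0

/-- The vector `e^i ⊕ λ e^j` (i-th coordinate `max 1 (λ·[i=j])`, j-th coordinate `λ`). -/
def duet {n : ℕ} (i j : Fin n) (lam : ℝ≥0) : Fin n → ℝ≥0 :=
  fun k => max (unitVec i k) (lam * unitVec j k)

/-- Tropical linear span (cone generated by `R`): all finite tropical linear combinations. -/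
def tropSpan {n : ℕ} (R : Set (Fin n → ℝ≥0)) : Set (Fin n → ℝ≥0) :=
  {x | ∃ (m : ℕ) (r : Fin m → Fin n → ℝ≥0) (l : Fin m → ℝ≥0),
    (∀ k, r k ∈ R) ∧ x = fun i => Finset.univ.sup fun k => l k * r k i}

/-- Tropical convex hull: all finite tropical convex combinations. -/
def tropConv {n : ℕ} (P : Set (Fin n → ℝ≥0)) : Set (Fin n → ℝ≥0) :=
  {x | ∃ (m : ℕ) (p : Fin m → Fin n → ℝ≥0) (l : Fin m → ℝ≥0),
    (∀ k, p k ∈ P) ∧ Finset.univ.sup l = 1 ∧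
    x = fun i => Finset.univ.sup fun k => l k * p k i}

/-- Tropical Minkowski sum of two sets. -/
def tropMink {n : ℕ} (A B : Set (Fin n → ℝ≥0)) : Set (Fin n → ℝ≥0) :=
  {z | ∃ a ∈ A, ∃ b ∈ B, z = fun i => max (a i) (b i)}

open scoped ENNReal Pointwise

/-- A conical hemispace: a tropical cone whose complement, enlarged with `0`, is also a
tropical cone. -/
def IsConicalHemispace {n : ℕ} (V : Set (Fin n → ℝ≥0)) : Prop :=
  TropCone V ∧ ∃ V2 : Set (Fin n → ℝ≥0), TropCone V2 ∧ V ∩ V2 = {0} ∧ V ∪ V2 = Set.univ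

/-- An admissible boundary set: a nonempty proper subset of `[0,∞]` of the form
`{λ ∈ ℝ≥0 | λ ≤ s}` or `{λ ∈ ℝ≥0 | λ < s}` for some `s ∈ [0,∞]`. -/
def AdmissibleSet (S : Set ℝ≥0∞) : Prop :=
  S.Nonempty ∧ S ≠ Set.univ ∧
    ∃ s : ℝ≥0∞, S = {l | l ≠ ⊤ ∧ l ≤ s} ∨ S = {l | l ≠ ⊤ ∧ l < s}

/-- The vector `e^i ⊕ λ e^j` for `λ ∈ [0,∞]`, with the convention `e^i ⊕ (+∞)·e^j := e^j`. -/
noncomputable def duetE {n : ℕ} (i j : Fin n) (lam : ℝ≥0∞) : Fin n → ℝ≥0 :=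
  if lam = ⊤ then unitVec j else duet i j lam.toNNReal

theorem AdmissibleSet.ne_top {S : Set ℝ≥0∞} (h : AdmissibleSet S) {a : ℝ≥0∞} (ha : a ∈ S) :
    a ≠ ⊤ := by
  obtain ⟨-, -, s, rfl | rfl⟩ := h <;> exact ha.1

theorem AdmissibleSet.mem_of_le {S : Set ℝ≥0∞} (h : AdmissibleSet S) {a b : ℝ≥0∞}
    (hb : b ∈ S) (hab : a ≤ b) : a ∈ S := by
  have ha : a ≠ ⊤ := ne_top_of_le_ne_top (h.ne_top hb) hab
  obtain ⟨-, -, s, rfl | rfl⟩ := h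
  · exact ⟨ha, hab.trans hb.2⟩
  · exact ⟨ha, hab.trans_lt hb.2⟩

theorem AdmissibleSet.zero_mem {S : Set ℝ≥0∞} (h : AdmissibleSet S) : 0 ∈ S := by
  obtain ⟨a, ha⟩ := h.1
  exact h.mem_of_le ha zero_le

section Duet

variable {n : ℕ} {i j k : Fin n}

theorem duetE_coe_left (hij : i ≠ j) (a : ℝ≥0) : duetE i j a i = 1 := by
  simp [duetE, duet, unitVec, hij]

theorem duetE_coe_right (hij : i ≠ j) (a : ℝ≥0) : duetE i j a j = a := by
  simp [duetE, duet, unitVec, hij.symm]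

theorem duetE_coe_of_ne (hki : k ≠ i) (hkj : k ≠ j) (a : ℝ≥0) : duetE i j a k = 0 := by
  simp [duetE, duet, unitVec, hki, hkj]

theorem duetE_top : duetE i j ⊤ = unitVec j := if_pos rfl

theorem mul_duetE_coe_le {x : Fin n → ℝ≥0} (hij : i ≠ j) {c a : ℝ≥0} (hi : c ≤ x i)
    (hj : c * a ≤ x j) (k : Fin n) : c * duetE i j a k ≤ x k := by
  by_cases hki : k = i
  · subst hki; simpa [duetE_coe_left hij] using hi
  by_cases hkj : k = j
  · subst hkj; simpa [duetE_coe_right hij] using hj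
  simp [duetE_coe_of_ne hki hkj]

theorem mul_unitVec_le (x : Fin n → ℝ≥0) (j k : Fin n) : x j * unitVec j k ≤ x k := by
  by_cases hkj : k = j
  · subst hkj; simp [unitVec]
  · simp [unitVec, hkj]

end Duet

section Span

variable {n : ℕ} {R C : Set (Fin n → ℝ≥0)}

theorem zero_mem_tropSpan (R : Set (Fin n → ℝ≥0)) : 0 ∈ tropSpan R :=
  ⟨0, Fin.elim0, Fin.elim0, fun k => k.elim0, by ext; simp⟩

/-- A vector lies in the cone generated by `R` as soon as each of its nonzero coordinates is
attained by a multiple of a generator lying below the vector. -/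
theorem mem_tropSpan_of_attained {x : Fin n → ℝ≥0}
    (h : ∀ k, x k ≠ 0 → ∃ r ∈ R, ∃ c : ℝ≥0, (∀ i, c * r i ≤ x i) ∧ c * r k = x k) :
    x ∈ tropSpan R := by
  by_cases hx : ∃ k, x k ≠ 0
  · obtain ⟨k₀, hk₀⟩ := hx
    obtain ⟨r₀, hr₀, -⟩ := h k₀ hk₀
    have h' : ∀ k, ∃ r ∈ R, ∃ c : ℝ≥0, (∀ i, c * r i ≤ x i) ∧ c * r k = x k := by
      intro k
      by_cases hk : x k = 0
      · exact ⟨r₀, hr₀, 0, by simp, by simp [hk]⟩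
      · exact h k hk
    choose r hr c hle heq using h'
    refine ⟨n, r, c, hr, funext fun i => le_antisymm ?_ ?_⟩
    · exact (heq i).ge.trans (Finset.le_sup (f := fun k => c k * r k i) (Finset.mem_univ i))
    · exact Finset.sup_le fun k _ => hle k i
  · push Not at hx
    rw [show x = 0 from funext hx]
    exact zero_mem_tropSpan R

theorem TropCone.zero_mem (hC : TropCone C) : 0 ∈ C := by
  obtain ⟨⟨x, hx⟩, -, hsmul⟩ := hC
  have h := hsmul x hx 0
  simp only [zero_mul] at h
  exact h

theorem TropCone.tropSpan_subset (hC : TropCone C) (hR : R ⊆ C) : tropSpan R ⊆ C := by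
  rintro x ⟨m, r, l, hr, rfl⟩
  suffices h : ∀ s : Finset (Fin m), (fun i => s.sup fun k => l k * r k i) ∈ C from h _
  intro s
  induction s using Finset.induction_on with
  | empty => exact hC.zero_mem
  | insert a s _ ih =>
    simp only [Finset.sup_insert]
    exact hC.2.1 _ (hC.2.2 _ (hR (hr a)) _) _ ih

end Span

section Duets

variable {n : ℕ} {I : Set (Fin n)} {σ : Fin n → Fin n → Set ℝ≥0∞}

theorem exists_ratio_mem_of_mem_tropSpan (hσ : ∀ i ∈ I, ∀ j ∉ I, AdmissibleSet (σ i j))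
    {x : Fin n → ℝ≥0}
    (hx : x ∈ tropSpan {v | ∃ i ∈ I, ∃ j ∉ I, ∃ lam ∈ σ i j, v = duetE i j lam})
    {j : Fin n} (hj : j ∉ I) (hxj : x j ≠ 0) :
    ∃ i ∈ I, x i ≠ 0 ∧ ((x j / x i : ℝ≥0) : ℝ≥0∞) ∈ σ i j := by
  obtain ⟨m, r, l, hr, hxe⟩ := hx
  have hm : (Finset.univ : Finset (Fin m)).Nonempty := by
    by_contra hne
    rw [Finset.not_nonempty_iff_eq_empty] at hne
    exact hxj (by simp [hxe, hne])
  obtain ⟨k, -, hk⟩ := Finset.exists_mem_eq_sup Finset.univ hm fun k => l k * r k j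
  have hxk : x j = l k * r k j := by rw [hxe]; exact hk
  obtain ⟨i, hi, j', hj', lam, hlam, hrk⟩ := hr k
  lift lam to ℝ≥0 using (hσ i hi j' hj').ne_top hlam
  have hij : i ≠ j := fun h => hj (h ▸ hi)
  have hjj : j' = j := by
    by_contra hne
    exact hxj (by rw [hxk, hrk, duetE_coe_of_ne hij.symm (Ne.symm hne), mul_zero])
  subst hjj
  have hxl : x j' = l k * lam := by rw [hxk, hrk, duetE_coe_right hij]
  have hle : l k ≤ x i := by
    have h : l k * r k i ≤ x i := by
      rw [hxe]
      exact Finset.le_sup (f := fun k => l k * r k i) (Finset.mem_univ k)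
    rwa [hrk, duetE_coe_left hij, mul_one] at h
  have hl : 0 < l k := pos_iff_ne_zero.2 fun h => hxj (by rw [hxl, h, zero_mul])
  have hxi : 0 < x i := hl.trans_le hle
  refine ⟨i, hi, hxi.ne', (hσ i hi j' hj).mem_of_le hlam (ENNReal.coe_le_coe.2 ?_)⟩
  rw [div_le_iff₀ hxi, hxl, mul_comm]
  gcongr

theorem duetE_notMem_tropSpan (hσ : ∀ i ∈ I, ∀ j ∉ I, AdmissibleSet (σ i j))
    {i j : Fin n} (hi : i ∈ I) (hj : j ∉ I) {lam : ℝ≥0∞} (hlam : lam ∉ σ i j) :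
    duetE i j lam ∉
      tropSpan {v | ∃ i ∈ I, ∃ j ∉ I, ∃ lam ∈ σ i j, v = duetE i j lam} := by
  intro hmem
  have hij : i ≠ j := fun h => hj (h ▸ hi)
  induction lam with
  | top =>
    rw [duetE_top] at hmem
    obtain ⟨i', hi', hne, -⟩ :=
      exists_ratio_mem_of_mem_tropSpan hσ hmem hj (by simp [unitVec])
    exact hne (if_neg fun h : i' = j => hj (h ▸ hi'))
  | coe a =>
    have ha : a ≠ 0 := by
      rintro rfl
      exact hlam (by simpa using (hσ i hi j hj).zero_mem)
    obtain ⟨i', hi', hne, h⟩ :=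
      exists_ratio_mem_of_mem_tropSpan hσ hmem hj (by rwa [duetE_coe_right hij])
    have hii : i' = i := by
      by_contra hii
      exact hne (duetE_coe_of_ne hii (fun h : i' = j => hj (h ▸ hi')) a)
    subst hii
    rw [duetE_coe_left hij, duetE_coe_right hij, div_one] at h
    exact hlam h

theorem mem_tropSpan_of_exists_ratio_mem (hI : I ≠ Set.univ)
    (hσ : ∀ i ∈ I, ∀ j ∉ I, AdmissibleSet (σ i j)) {x : Fin n → ℝ≥0}
    (hx : ∀ j ∉ I, x j ≠ 0 → ∃ i ∈ I, x i ≠ 0 ∧ ((x j / x i : ℝ≥0) : ℝ≥0∞) ∈ σ i j) :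
    x ∈ tropSpan {v | ∃ i ∈ I, ∃ j ∉ I, ∃ lam ∈ σ i j, v = duetE i j lam} := by
  obtain ⟨j₀, hj₀⟩ := (Set.ne_univ_iff_exists_notMem I).1 hI
  refine mem_tropSpan_of_attained fun k hk => ?_
  by_cases hkI : k ∈ I
  · have hkj : k ≠ j₀ := fun h => hj₀ (h ▸ hkI)
    refine ⟨_, ⟨k, hkI, j₀, hj₀, (0 : ℝ≥0), (hσ k hkI j₀ hj₀).zero_mem, rfl⟩, x k,
      mul_duetE_coe_le hkj le_rfl (by simp), ?_⟩
    rw [duetE_coe_left hkj, mul_one]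
  · obtain ⟨i, hi, hxi, hmem⟩ := hx k hkI hk
    have hik : i ≠ k := fun h => hkI (h ▸ hi)
    refine ⟨_, ⟨i, hi, k, hkI, _, hmem, rfl⟩, x i,
      mul_duetE_coe_le hik le_rfl (mul_div_cancel₀ _ hxi).le, ?_⟩
    rw [duetE_coe_right hik, mul_div_cancel₀ _ hxi]

theorem mem_tropSpan_compl_of_forall_ratio_notMem (hI : I.Nonempty)
    (hσ : ∀ i ∈ I, ∀ j ∉ I, AdmissibleSet (σ i j)) {x : Fin n → ℝ≥0} {j : Fin n} (hj : j ∉ I)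
    (hx : ∀ i ∈ I, x i ≠ 0 → ((x j / x i : ℝ≥0) : ℝ≥0∞) ∉ σ i j) :
    x ∈ tropSpan {v | ∃ i ∈ I, ∃ j ∉ I, ∃ lam ∈ (σ i j)ᶜ, v = duetE i j lam} := by
  obtain ⟨i₀, hi₀⟩ := hI
  refine mem_tropSpan_of_attained fun k hk => ?_
  by_cases hkI : k ∈ I
  · have hkj : k ≠ j := fun h => hj (h ▸ hkI)
    refine ⟨_, ⟨k, hkI, j, hj, _, hx k hkI hk, rfl⟩, x k,
      mul_duetE_coe_le hkj le_rfl (mul_div_cancel₀ _ hk).le, ?_⟩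
    rw [duetE_coe_left hkj, mul_one]
  · refine ⟨_, ⟨i₀, hi₀, k, hkI, ⊤, fun h => (hσ i₀ hi₀ k hkI).ne_top h rfl, rfl⟩, x k, ?_, ?_⟩
    · rw [duetE_top]
      exact mul_unitVec_le x k
    · simp [duetE_top, unitVec]

end Duets

theorem stmt14 {n : ℕ} (I : Set (Fin n)) (hI : I.Nonempty) (hIne : I ≠ Set.univ)
    (σm : Fin n → Fin n → Set ℝ≥0∞)
    (hadm : ∀ i ∈ I, ∀ j ∉ I, AdmissibleSet (σm i j))
    (hhemi : IsConicalHemispace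
      (tropSpan {v | ∃ i ∈ I, ∃ j ∉ I, ∃ lam ∈ σm i j, v = duetE i j lam})) :
    tropSpan {v | ∃ i ∈ I, ∃ j ∉ I, ∃ lam ∈ σm i j, v = duetE i j lam} ∩
      tropSpan {v | ∃ i ∈ I, ∃ j ∉ I, ∃ lam ∈ (σm i j)ᶜ, v = duetE i j lam} = {0} ∧
    tropSpan {v | ∃ i ∈ I, ∃ j ∉ I, ∃ lam ∈ σm i j, v = duetE i j lam} ∪
      tropSpan {v | ∃ i ∈ I, ∃ j ∉ I, ∃ lam ∈ (σm i j)ᶜ, v = duetE i j lam} = Set.univ := by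
  constructor
  · obtain ⟨-, W, hW, hinter, hunion⟩ := hhemi
    refine Set.Subset.antisymm ?_
      (Set.singleton_subset_iff.2 ⟨zero_mem_tropSpan _, zero_mem_tropSpan _⟩)
    rintro z ⟨hz₁, hz₂⟩
    rw [← hinter]
    refine ⟨hz₁, hW.tropSpan_subset ?_ hz₂⟩
    rintro v ⟨i, hi, j, hj, lam, hlam, rfl⟩
    exact (hunion.ge (Set.mem_univ _)).resolve_left (duetE_notMem_tropSpan hadm hi hj hlam)
  · refine Set.eq_univ_of_forall fun x => or_iff_not_imp_left.2 fun hx => ?_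
    have h := mt (mem_tropSpan_of_exists_ratio_mem hIne hadm) hx
    push Not at h
    obtain ⟨j, hj, -, hratio⟩ := h
    exact mem_tropSpan_compl_of_forall_ratio_notMem hI hadm hj hratio
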